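/- arXiv:2407.18816 — 2 statements merged into one kernel-verified Lean document; each statement's English description precedes it below -/
import Mathlib

section
/- Let S = conv(v₀, …, v_d) ⊂ ℝ^d be a d-simplex and let C₀, …, C_d be closed subsets of S such that for every nonempty subset {i₁, …, iₙ} ⊆ {0, 1, …, d} one has conv(v_{i₁}, …, v_{iₙ}) ⊆ C_{i₁} ∪ ⋯ ∪ C_{iₙ}. Then there exists a point u ∈ S with u ∈ C_i for every i = 0, …, d; that is, ⋂_{i=0}^{d} C_i is nonempty. -/
namespace KKMAux

open Finset

/-- `σ` is dominant: no point exceeds the minimum of `σ` in every order. -/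
def Dom {X I : Type*} (w : I → X → ℕ) (σ : Finset X) : Prop :=
  ∀ y, ∃ i, ∀ x ∈ σ, w i y ≤ w i x

noncomputable instance {X I : Type*} (w : I → X → ℕ) (σ : Finset X) : Decidable (Dom w σ) :=
  Classical.propDecidable _

section comb

variable {X I : Type*} [Fintype X] [DecidableEq X] [Fintype I] [DecidableEq I]

theorem exists_pair (τ : Finset X) (hcard : τ.card + 1 = Fintype.card I)
    (m : I → X) (hm : ∀ i, m i ∈ τ) (hsurj : ∀ x ∈ τ, ∃ i, m i = x) :
    ∃ i j, i ≠ j ∧ m i = m j ∧ ∀ a b, a ≠ b → m a = m b → (a = i ∧ b = j) ∨ (a = j ∧ b = i) := by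
  obtain ⟨i, -, j, -, hij, hmij⟩ : ∃ i ∈ (univ : Finset I), ∃ j ∈ (univ : Finset I), i ≠ j ∧ m i = m j :=
    Finset.exists_ne_map_eq_of_card_lt_of_maps_to (t := τ) (by rw [card_univ]; omega)
      (fun a _ => hm a)
  have key : ∀ k, (∃ l, l ≠ k ∧ m l = m k) → Set.InjOn m ((univ.erase k : Finset I) : Set I) := by
    rintro k ⟨l, hlk, hl⟩
    have himg : (univ.erase k).image m = τ := by
      ext x
      simp only [mem_image, mem_erase, mem_univ, and_true]
      constructor
      · rintro ⟨a, -, rfl⟩; exact hm a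
      · intro hx
        obtain ⟨a, rfl⟩ := hsurj x hx
        by_cases h : a = k
        · exact ⟨l, hlk, by rw [hl, h]⟩
        · exact ⟨a, h, rfl⟩
    apply Finset.injOn_of_card_image_eq
    rw [himg, card_erase_of_mem (mem_univ _), card_univ]; omega
  have hi := key i ⟨j, hij.symm, hmij.symm⟩
  have hj := key j ⟨i, hij, hmij⟩
  refine ⟨i, j, hij, hmij, fun a b hab h => ?_⟩
  have h1 : a = i ∨ b = i := by
    by_contra! hc
    exact hab (hi (by simp [hc.1]) (by simp [hc.2]) h)
  have h2 : a = j ∨ b = j := by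
    by_contra! hc
    exact hab (hj (by simp [hc.1]) (by simp [hc.2]) h)
  grind

/-- internal doors lie in exactly two rooms -/
theorem internal_door (w : I → X → ℕ) (hw : ∀ i, Function.Injective (w i))
    (τ : Finset X) (hcard : τ.card + 1 = Fintype.card I) (hne : τ.Nonempty)
    (hdom : Dom w τ)
    (s : I → X) (hs : ∀ k l, l ≠ k → ∃ x ∈ τ, w l x < w l (s k)) :
    (univ.filter (fun y => y ∉ τ ∧ Dom w (insert y τ))).card = 2 := by
  have hmin : ∀ i, ∃ x ∈ τ, ∀ z ∈ τ, w i x ≤ w i z := fun i => exists_min_image τ (w i) hne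
  choose m hmτ hmle using hmin
  have hsurj : ∀ x ∈ τ, ∃ i, m i = x := by
    intro x hx
    obtain ⟨i, hi⟩ := hdom x
    exact ⟨i, hw i (le_antisymm (hmle i x hx) (hi _ (hmτ i)))⟩
  obtain ⟨i, j, hij, hmij, hpair⟩ := exists_pair τ hcard m hmτ hsurj
  let M : I → Finset X := fun k => univ.filter (fun y => ∀ l, l ≠ k → w l (m l) < w l y)
  have hM : ∀ k y, y ∈ M k ↔ ∀ l, l ≠ k → w l (m l) < w l y := by intro k y; simp [M]
  have hMne : ∀ k, (M k).Nonempty := by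
    intro k
    refine ⟨s k, (hM _ _).2 fun l hl => ?_⟩
    obtain ⟨x, hx, hlt⟩ := hs k l hl
    exact lt_of_le_of_lt (hmle l x hx) hlt
  have hmax : ∀ k, ∃ y ∈ M k, ∀ z ∈ M k, w k z ≤ w k y := fun k => exists_max_image _ _ (hMne k)
  choose Y hYM hYmax using hmax
  have hsurj' : ∀ k, (k = i ∨ k = j) → ∀ x ∈ τ, ∃ a, a ≠ k ∧ m a = x := by
    intro k hk x hx
    obtain ⟨a, ha⟩ := hsurj x hx
    by_cases h : a = k
    · grind
    · exact ⟨a, h, ha⟩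
  have hback : ∀ k, (k = i ∨ k = j) → Y k ∉ τ ∧ Dom w (insert (Y k) τ) := by
    intro k hk
    have hYk := (hM _ _).1 (hYM k)
    constructor
    · intro hmem
      obtain ⟨a, hak, ha⟩ := hsurj' k hk _ hmem
      have := hYk a hak
      rw [ha] at this
      exact lt_irrefl _ this
    · intro z
      by_cases hz : z ∈ M k
      · refine ⟨k, ?_⟩
        obtain ⟨a, ha⟩ := hdom z
        have hak : a = k := by
          by_contra h
          exact absurd ((hM _ _).1 hz a h) (not_lt.2 (ha _ (hmτ a)))
        subst hak
        intro x hx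
        rcases mem_insert.1 hx with rfl | hx
        · exact hYmax _ z hz
        · exact ha x hx
      · rw [hM] at hz
        push Not at hz
        obtain ⟨l, hl, hzl⟩ := hz
        refine ⟨l, fun x hx => ?_⟩
        rcases mem_insert.1 hx with rfl | hx
        · exact hzl.trans (hYk l hl).le
        · exact hzl.trans (hmle l x hx)
  rw [card_eq_two]
  refine ⟨Y i, Y j, ?_, ?_⟩
  · intro h
    obtain ⟨a, ha⟩ := hdom (Y i)
    have h1 := ha _ (hmτ a)
    by_cases hai : a = i
    · have := (hM _ _).1 (hYM j) a (by rw [hai]; exact hij)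
      rw [← h] at this; omega
    · have := (hM _ _).1 (hYM i) a hai
      omega
  · ext y
    simp only [mem_filter, mem_univ, true_and, mem_insert, mem_singleton]
    constructor
    · rintro ⟨hyτ, hy⟩
      obtain ⟨k, hk⟩ := hy y
      have hgood : ∀ x ∈ τ, ∃ a, a ≠ k ∧ m a = x ∧ w a x < w a y := by
        intro x hx
        obtain ⟨a, ha⟩ := hy x
        have hxy : x ≠ y := by rintro rfl; exact hyτ hx
        have hlt : w a x < w a y := lt_of_le_of_ne (ha y (mem_insert_self _ _))
          (fun h => hxy (hw a h))
        refine ⟨a, ?_, ?_, hlt⟩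
        · rintro rfl
          have := hk x (mem_insert_of_mem hx)
          omega
        · exact hw a (le_antisymm (hmle a x hx) (ha _ (mem_insert_of_mem (hmτ a))))
      have hkij : k = i ∨ k = j := by
        obtain ⟨a, hak, ha, -⟩ := hgood _ (hmτ k)
        rcases hpair a k hak ha with h | h
        · exact Or.inr h.2
        · exact Or.inl h.2
      have hyM : y ∈ M k := by
        rw [hM]
        intro l hl
        obtain ⟨a, hak, ha, hlt⟩ := hgood _ (hmτ l)
        by_cases hal : a = l
        · rw [hal] at hlt; exact hlt
        · exfalso
          have := hpair a l hal ha
          grind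
      have hyY : y = Y k := by
        apply hw k
        apply le_antisymm (hYmax k y hyM)
        obtain ⟨a, ha⟩ := hy (Y k)
        have hak : a = k := by
          by_contra h
          exact absurd ((hM _ _).1 (hYM k) a h) (not_lt.2 (ha _ (mem_insert_of_mem (hmτ a))))
        subst hak
        exact ha y (mem_insert_self _ _)
      rcases hkij with rfl | rfl
      · exact Or.inl hyY
      · exact Or.inr hyY
    · rintro (rfl | rfl)
      · exact hback i (Or.inl rfl)
      · exact hback j (Or.inr rfl)

/-- the boundary door lies in exactly one room -/
theorem boundary_door (w : I → X → ℕ) (hw : ∀ i, Function.Injective (w i))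
    (s : I → X) (hs : Function.Injective s) (hmin : ∀ i x, w i (s i) ≤ w i x)
    (htop : ∀ i j, i ≠ j → ∀ x, (∀ k, x ≠ s k) → w i x < w i (s j)) (i : I) :
    (univ.filter (fun y => y ∉ (univ.erase i).image s ∧
      Dom w (insert y ((univ.erase i).image s)))).card = 1 := by
  set τ := (univ.erase i).image s with hτ
  have hmem : ∀ x, x ∈ τ ↔ ∃ a, a ≠ i ∧ s a = x := by intro x; simp [hτ]
  have hsi : s i ∈ univ.filter (fun y => y ∉ τ) := by
    simp only [mem_filter, mem_univ, true_and, hmem]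
    rintro ⟨a, ha, h⟩
    exact ha (hs h)
  obtain ⟨Y, hY, hYmax⟩ := exists_max_image (univ.filter (fun y => y ∉ τ)) (w i) ⟨_, hsi⟩
  simp only [mem_filter, mem_univ, true_and] at hY hYmax
  rw [card_eq_one]
  refine ⟨Y, ?_⟩
  ext y
  simp only [mem_filter, mem_univ, true_and, mem_singleton]
  constructor
  · rintro ⟨hy, hd⟩
    apply hw i
    apply le_antisymm (hYmax y hy)
    obtain ⟨a, ha⟩ := hd Y
    have hai : a = i := by
      by_contra h
      have hsa : s a ∈ τ := (hmem _).2 ⟨a, h, rfl⟩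
      have := hw a (le_antisymm (hmin a Y) (ha _ (mem_insert_of_mem hsa)))
      exact hY (this ▸ hsa)
    subst hai
    exact ha y (mem_insert_self _ _)
  · rintro rfl
    refine ⟨hY, fun z => ?_⟩
    by_cases hz : z ∈ τ
    · obtain ⟨a, -, rfl⟩ := (hmem _).1 hz
      exact ⟨a, fun x _ => hmin a x⟩
    · refine ⟨i, fun x hx => ?_⟩
      rcases mem_insert.1 hx with rfl | hx
      · exact hYmax z hz
      · obtain ⟨b, hb, rfl⟩ := (hmem _).1 hx
        by_cases hk : ∃ k, z = s k
        · obtain ⟨k, rfl⟩ := hk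
          have : k = i := by
            by_contra h
            exact hz ((hmem _).2 ⟨k, h, rfl⟩)
          subst this
          exact hmin _ _
        · push Not at hk
          exact (htop i b (Ne.symm hb) z hk).le

/-- a non-colourful room has an even number of doors -/
theorem room_even (c : X → I) (σ : Finset X) (hcard : σ.card = Fintype.card I)
    (hc : σ.image c ≠ univ) (i : I) :
    Even ((σ.filter (fun x => (σ.erase x).image c = univ.erase i)).card) := by
  by_cases h : ∃ x ∈ σ, (σ.erase x).image c = univ.erase i
  swap
  · rw [filter_eq_empty_iff.2]
    · simp
    · push Not at h
      exact fun x hx => h x hx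
  obtain ⟨x, hx, hxe⟩ := h
  have hcov : ∀ k, k ≠ i → ∃ z ∈ σ, z ≠ x ∧ c z = k := by
    intro k hk
    have : k ∈ (σ.erase x).image c := by rw [hxe]; simp [hk]
    simp only [mem_image, mem_erase] at this
    obtain ⟨z, ⟨h1, h2⟩, h3⟩ := this
    exact ⟨z, h2, h1, h3⟩
  have hno : ∀ z ∈ σ, c z ≠ i := by
    intro z hz hzi
    apply hc
    rw [eq_univ_iff_forall]
    intro k
    by_cases hk : k = i
    · exact mem_image.2 ⟨z, hz, by rw [hzi, hk]⟩
    · obtain ⟨z', h1, -, h3⟩ := hcov k hk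
      exact mem_image.2 ⟨z', h1, h3⟩
  have hinj : Set.InjOn c ((σ.erase x : Finset X) : Set X) := by
    apply Finset.injOn_of_card_image_eq
    rw [hxe, card_erase_of_mem (mem_univ _), card_erase_of_mem hx, card_univ, hcard]
  obtain ⟨x', hx', hxx', hcx⟩ := hcov (c x) (hno x hx)
  have hset : σ.filter (fun x => (σ.erase x).image c = univ.erase i) = {x, x'} := by
    ext y
    simp only [mem_filter, mem_insert, mem_singleton]
    constructor
    · rintro ⟨hy, hye⟩
      by_contra! hne
      have : c y ∈ (σ.erase y).image c := by rw [hye]; simp [hno y hy]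
      simp only [mem_image, mem_erase] at this
      obtain ⟨z, ⟨hzy, hz⟩, hcz⟩ := this
      by_cases hzx : z = x
      · subst hzx
        exact hne.2 (hinj (by simp [hy, hne.1]) (by simp [hx', hxx']) (by rw [hcx, hcz]))
      · exact hzy (hinj (by simp [hz, hzx]) (by simp [hy, hne.1]) hcz)
    · rintro (rfl | rfl)
      · exact ⟨hx, hxe⟩
      · refine ⟨hx', ?_⟩
        ext k
        simp only [mem_image, mem_erase, mem_univ, and_true]
        constructor
        · rintro ⟨z, ⟨-, hz⟩, rfl⟩; exact hno z hz
        · intro hk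
          obtain ⟨z, hz, hzx, rfl⟩ := hcov k hk
          by_cases hzy : z = y
          · exact ⟨x, ⟨hxx'.symm, hx⟩, by rw [hzy, hcx]⟩
          · exact ⟨z, ⟨hzy, hz⟩, rfl⟩
  rw [hset, card_pair hxx'.symm]
  exact even_two

theorem exists_colourful (w : I → X → ℕ) (hw : ∀ i, Function.Injective (w i))
    (s : I → X) (hs : Function.Injective s) (hmin : ∀ i x, w i (s i) ≤ w i x)
    (htop : ∀ i j, i ≠ j → ∀ x, (∀ k, x ≠ s k) → w i x < w i (s j))
    (c : X → I) (hc : ∀ i, c (s i) = i) (i : I) :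
    ∃ σ : Finset X, Dom w σ ∧ σ.image c = univ := by
  by_contra! hcon
  -- incidence pairs counted from the room side
  let B : Finset (Finset X × X) := univ.filter (fun p => p.1.card = Fintype.card I ∧ Dom w p.1 ∧
    p.2 ∈ p.1 ∧ (p.1.erase p.2).image c = univ.erase i)
  let A : Finset (Finset X × X) := univ.filter (fun p => p.1.card + 1 = Fintype.card I ∧
    p.1.image c = univ.erase i ∧ p.2 ∉ p.1 ∧ Dom w (insert p.2 p.1))
  have hAB : A.card = B.card := by
    refine card_bij' (fun p _ => (insert p.2 p.1, p.2)) (fun p _ => (p.1.erase p.2, p.2)) ?_ ?_ ?_ ?_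
    · rintro ⟨τ, y⟩ h
      simp only [A, B, mem_filter, mem_univ, true_and] at h ⊢
      obtain ⟨h1, h2, h3, h4⟩ := h
      refine ⟨by rw [card_insert_of_notMem h3, h1], h4, mem_insert_self _ _, ?_⟩
      rw [erase_insert h3, h2]
    · rintro ⟨τ, y⟩ h
      simp only [A, B, mem_filter, mem_univ, true_and] at h ⊢
      obtain ⟨h1, h2, h3, h4⟩ := h
      refine ⟨by rw [card_erase_add_one h3, h1], h4, by simp, ?_⟩
      rw [insert_erase h3]; exact h2
    · rintro ⟨τ, y⟩ h
      simp only [A, mem_filter, mem_univ, true_and] at h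
      simp [erase_insert h.2.2.1]
    · rintro ⟨τ, y⟩ h
      simp only [B, mem_filter, mem_univ, true_and] at h
      simp [insert_erase h.2.2.1]
  have hBsum : B.card = ∑ σ : Finset X, (univ.filter (fun y => (σ, y) ∈ B)).card := by
    simp only [card_filter]
    rw [← Fintype.sum_prod_type' (f := fun σ y => if (σ, y) ∈ B then 1 else 0)]
    rw [← card_filter]; simp
  have hAsum : A.card = ∑ σ : Finset X, (univ.filter (fun y => (σ, y) ∈ A)).card := by
    simp only [card_filter]
    rw [← Fintype.sum_prod_type' (f := fun σ y => if (σ, y) ∈ A then 1 else 0)]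
    rw [← card_filter]; simp
  have hBeven : Even B.card := by
    rw [hBsum]
    apply even_sum
    intro σ _
    by_cases h : σ.card = Fintype.card I ∧ Dom w σ
    · have := room_even c σ h.1 (hcon σ h.2) i
      have h2 : univ.filter (fun y => (σ, y) ∈ B) =
          σ.filter (fun x => (σ.erase x).image c = univ.erase i) := by
        ext y
        simp [B, h.1, h.2]
      rw [h2]
      exact this
    · rw [filter_eq_empty_iff.2]
      · simp
      · intro y _ hy
        simp only [B, mem_filter, mem_univ, true_and] at hy
        exact h ⟨hy.1, hy.2.1⟩
  have hAodd : Odd A.card := by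
    rw [hAsum]
    set τ₀ := (univ.erase i).image s with hτ₀
    rw [← add_sum_erase _ _ (mem_univ τ₀)]
    apply Odd.add_even
    · have h1 := boundary_door w hw s hs hmin htop i
      rw [← hτ₀] at h1
      have h2 : univ.filter (fun y => (τ₀, y) ∈ A) =
          univ.filter (fun y => y ∉ τ₀ ∧ Dom w (insert y τ₀)) := by
        ext y
        have hca : τ₀.card + 1 = Fintype.card I := by
          rw [hτ₀, card_image_of_injective _ hs, card_erase_add_one (mem_univ _), card_univ]
        have him : τ₀.image c = univ.erase i := by
          rw [hτ₀, image_image]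
          have hcs : c ∘ s = id := funext hc
          rw [hcs, image_id]
        simp [A, hca, him]
      rw [h2, h1]; exact odd_one
    · apply even_sum
      intro τ hτ
      have hne : τ ≠ τ₀ := (mem_erase.1 hτ).1
      by_cases hempty : (univ.filter (fun y => (τ, y) ∈ A)) = ∅
      · rw [hempty]; simp
      obtain ⟨y₀, hy₀⟩ := nonempty_iff_ne_empty.2 hempty
      simp only [A, mem_filter, mem_univ, true_and] at hy₀
      obtain ⟨h1, h2, h3, h4⟩ := hy₀
      have hsl : ∀ x ∈ τ, ∀ k, x = s k → k ≠ i := by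
        rintro x hx k rfl
        have : c (s k) ∈ τ.image c := mem_image_of_mem _ hx
        rw [h2, hc] at this
        exact (mem_erase.1 this).1
      have hall : ¬ ∀ x ∈ τ, ∃ k, x = s k := by
        intro hall
        apply hne
        ext x
        simp only [hτ₀, mem_image, mem_erase, mem_univ, and_true]
        constructor
        · intro hx
          obtain ⟨k, rfl⟩ := hall x hx
          exact ⟨k, hsl _ hx k rfl, rfl⟩
        · rintro ⟨a, ha, rfl⟩
          have : a ∈ τ.image c := by rw [h2]; simp [ha]
          obtain ⟨x, hx, hxa⟩ := mem_image.1 this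
          obtain ⟨k, rfl⟩ := hall x hx
          rw [hc] at hxa
          exact hxa ▸ hx
      push Not at hall
      obtain ⟨x, hx, hxs⟩ := hall
      have hd : Dom w τ := by
        intro y
        obtain ⟨a, ha⟩ := h4 y
        exact ⟨a, fun x hx => ha x (mem_insert_of_mem hx)⟩
      have := internal_door w hw τ h1 ⟨x, hx⟩ hd s
        (fun k l hl => ⟨x, hx, htop l k hl x hxs⟩)
      have h5 : univ.filter (fun y => (τ, y) ∈ A) =
          univ.filter (fun y => y ∉ τ ∧ Dom w (insert y τ)) := by
        ext y
        simp [A, h1, h2]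
      rw [h5, this]; exact even_two
  rw [hAB] at hAodd
  exact (Nat.not_even_iff_odd.2 hAodd) hBeven

end comb

theorem scarf {T I : Type*} [Fintype T] [Fintype I] [DecidableEq I] [Nonempty I]
    (u : I → T → ℕ) (hu : ∀ i, Function.Injective (u i)) (c : T → I) :
    ∃ σ : Finset T, ∀ y, ∃ i ∈ σ.image c, ∀ x ∈ σ, u i y ≤ u i x := by
  classical
  let e := Fintype.equivFin I
  let B : ℕ := ∑ i, ∑ t, u i t
  have hB : ∀ i t, u i t ≤ B := fun i t =>
    (single_le_sum (f := fun t => u i t) (fun _ _ => Nat.zero_le _) (mem_univ t)).trans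
      (single_le_sum (f := fun i => ∑ t, u i t) (fun _ _ => Nat.zero_le _) (mem_univ i))
  let w : I → T ⊕ I → ℕ := fun i => Sum.elim (fun t => u i t + 1)
    (fun j => if j = i then 0 else B + 2 + e j)
  obtain ⟨σ, hd, hσ⟩ := exists_colourful (X := T ⊕ I) w
    (by
      rintro i (a | a) (b | b) h
      · simp only [w, Sum.elim_inl] at h
        rw [hu i (by omega : u i a = u i b)]
      · simp only [w, Sum.elim_inl, Sum.elim_inr] at h
        have := hB i a
        split_ifs at h <;> omega
      · simp only [w, Sum.elim_inl, Sum.elim_inr] at h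
        have := hB i b
        split_ifs at h <;> omega
      · simp only [w, Sum.elim_inr] at h
        split_ifs at h with h1 h2 h2
        · rw [h1, h2]
        · omega
        · omega
        · have : e a = e b := Fin.ext (by omega)
          rw [e.injective this])
    Sum.inr Sum.inr_injective (by intro i x; simp [w])
    (by
      rintro i j hij (x | x) hx
      · have := hB i x
        simp only [w, Sum.elim_inl, Sum.elim_inr, if_neg hij.symm]
        omega
      · exact absurd rfl (hx x))
    (Sum.elim c id) (by simp) (Classical.arbitrary I)
  refine ⟨univ.filter (fun t => Sum.inl t ∈ σ), fun y => ?_⟩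
  obtain ⟨i, hi⟩ := hd (Sum.inl y)
  refine ⟨i, ?_, ?_⟩
  · have : i ∈ σ.image (Sum.elim c id) := by rw [hσ]; simp
    obtain ⟨x | x, hx, hxi⟩ := mem_image.1 this
    · exact mem_image.2 ⟨x, by simpa using hx, by simpa using hxi⟩
    · simp only [Sum.elim_inr, id] at hxi
      subst hxi
      have := hi _ hx
      simp [w] at this
  · intro x hx
    have := hi (Sum.inl x) (by simpa using hx)
    simpa [w] using this

/-- approximate version on a grid of mesh `1/N` -/
theorem approx {I : Type*} [Fintype I] [DecidableEq I] [Nonempty I]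
    (g : I → (I → ℝ) → ℝ) (hg0 : ∀ i t, 0 ≤ g i t) (N : ℕ) (hN : 0 < N) :
    ∃ x ∈ stdSimplex ℝ I, ∃ z : I → I → ℝ, ∀ i,
      (∀ j, |z i j - x j| ≤ (Fintype.card I : ℝ) / N) ∧
      (z i i - (Fintype.card I : ℝ) / N) * (∑ j, g j (z i)) ≤ g i (z i) := by
  classical
  have hN' : (0 : ℝ) < N := by exact_mod_cast hN
  let T := {x : I → Fin (N + 1) // ∑ i, (x i : ℕ) = N}
  let p : T → I → ℝ := fun x i => ((x.1 i : ℕ) : ℝ) / N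
  have hp : ∀ x, p x ∈ stdSimplex ℝ I := by
    intro x
    refine ⟨fun i => by positivity, ?_⟩
    simp only [p]
    rw [← sum_div, div_eq_one_iff_eq hN'.ne']
    exact_mod_cast x.2
  have hlab : ∀ x : T, ∃ i, p x i * (∑ j, g j (p x)) ≤ g i (p x) := by
    intro x
    by_contra! hcon
    have : ∑ i, g i (p x) < ∑ i, p x i * (∑ j, g j (p x)) :=
      sum_lt_sum_of_nonempty univ_nonempty (fun i _ => hcon i)
    rw [← sum_mul, (hp x).2, one_mul] at this
    exact lt_irrefl _ this
  choose c hc using hlab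
  let e := Fintype.equivFin T
  let K := Fintype.card T
  obtain ⟨σ, hσ⟩ := scarf (T := T) (I := I) (fun i x => (x.1 i : ℕ) * K + e x)
    (by
      intro i a b h
      simp only at h
      have ha := (e a).2
      have hb := (e b).2
      have : ((e a : ℕ)) = e b := by
        have h' := congrArg (· % K) h
        simpa [Nat.mul_add_mod', Nat.mod_eq_of_lt, K] using h'
      exact e.injective (Fin.ext this)) c
  have hσ' : ∀ y : T, ∃ i ∈ σ.image c, ∀ x ∈ σ, (y.1 i : ℕ) ≤ x.1 i := by
    intro y
    obtain ⟨i, hi, h⟩ := hσ y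
    refine ⟨i, hi, fun x hx => ?_⟩
    have h1 := h x hx
    by_contra! hlt
    have h2 : ((x.1 i : ℕ) + 1) * K ≤ (y.1 i : ℕ) * K := Nat.mul_le_mul_right _ hlt
    have h3 : (e x : ℕ) < K := (e x).2
    have h4 : ((x.1 i : ℕ) + 1) * K = (x.1 i : ℕ) * K + K := by ring
    omega
  -- σ is nonempty
  have i₁ : I := Classical.arbitrary I
  have hT : ∃ y : T, True := by
    refine ⟨⟨fun i => if i = i₁ then Fin.last N else 0, ?_⟩, trivial⟩
    rw [sum_eq_single i₁]
    · simp
    · intro b _ hb; simp [hb]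
    · simp
  obtain ⟨y₀, -⟩ := hT
  obtain ⟨i₀, hi₀, -⟩ := hσ' y₀
  obtain ⟨x₀, hx₀, -⟩ := mem_image.1 hi₀
  have hmin : ∀ i, ∃ x ∈ σ, ∀ z ∈ σ, (x.1 i : ℕ) ≤ z.1 i :=
    fun i => exists_min_image σ (fun x => (x.1 i : ℕ)) ⟨x₀, hx₀⟩
  choose q hqσ hq using hmin
  let m : I → ℕ := fun i => (q i).1 i
  set S := σ.image c with hS
  have hbig : N < ∑ i ∈ S, (m i + 1) := by
    by_contra! hle
    let f : I → ℕ := fun i => (if i ∈ S then m i + 1 else 0) +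
      (if i = i₀ then N - ∑ i ∈ S, (m i + 1) else 0)
    have hf : ∑ i, f i = N := by
      simp only [f, sum_add_distrib, sum_ite_mem, univ_inter, sum_ite_eq', mem_univ, if_true]
      simp only [sum_add_distrib] at hle
      omega
    have hfN : ∀ i, f i < N + 1 := by
      intro i
      have := single_le_sum (f := f) (fun _ _ => Nat.zero_le _) (mem_univ i)
      omega
    obtain ⟨i, hi, h⟩ := hσ' ⟨fun i => ⟨f i, hfN i⟩, hf⟩
    have h1 := h (q i) (hqσ i)
    have h2 : m i + 1 ≤ f i := by simp only [f, if_pos hi]; omega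
    simp only at h1
    change f i ≤ m i at h1
    omega
  have hcardS : S.card ≤ Fintype.card I := card_le_univ S
  have hbig' : N < ∑ i ∈ S, m i + Fintype.card I := by
    rw [sum_add_distrib] at hbig
    simp only [sum_const, smul_eq_mul, mul_one] at hbig
    omega
  -- coordinate bounds
  have hcoord : ∀ x ∈ σ, ∀ j, ((x.1 j : ℕ)) ≤ (if j ∈ S then m j else 0) + Fintype.card I := by
    intro x hx j
    have hle : ∀ i, (if i ∈ S then m i else 0) ≤ (x.1 i : ℕ) := by
      intro i
      split_ifs
      · exact hq i x hx
      · exact Nat.zero_le _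
    have h1 : ∑ i ∈ univ.erase j, (if i ∈ S then m i else 0) ≤ ∑ i ∈ univ.erase j, (x.1 i : ℕ) :=
      sum_le_sum fun i _ => hle i
    have h2 := add_sum_erase univ (fun i => (x.1 i : ℕ)) (mem_univ j)
    have h3 := add_sum_erase univ (fun i => if i ∈ S then m i else 0) (mem_univ j)
    have h4 : ∑ i, (if i ∈ S then m i else 0) = ∑ i ∈ S, m i := by simp
    have h5 := x.2
    omega
  have hlow : ∀ x ∈ σ, ∀ j, (if j ∈ S then m j else 0) ≤ (x.1 j : ℕ) := by
    intro x hx i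
    split_ifs
    · exact hq i x hx
    · exact Nat.zero_le _
  have hclose : ∀ x ∈ σ, ∀ y ∈ σ, ∀ j, |p x j - p y j| ≤ (Fintype.card I : ℝ) / N := by
    intro x hx y hy j
    have h1 := hcoord x hx j
    have h2 := hcoord y hy j
    have h3 := hlow x hx j
    have h4 := hlow y hy j
    have h5 : (x.1 j : ℕ) ≤ (y.1 j : ℕ) + Fintype.card I := by omega
    have h6 : (y.1 j : ℕ) ≤ (x.1 j : ℕ) + Fintype.card I := by omega
    have h5' : ((x.1 j : ℕ) : ℝ) ≤ ((y.1 j : ℕ) : ℝ) + Fintype.card I := by exact_mod_cast h5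
    have h6' : ((y.1 j : ℕ) : ℝ) ≤ ((x.1 j : ℕ) : ℝ) + Fintype.card I := by exact_mod_cast h6
    simp only [p]
    rw [← sub_div, abs_div, abs_of_pos hN']
    gcongr
    rw [abs_le]
    constructor <;> linarith
  have hz : ∀ i, ∃ z : I → ℝ, (∀ j, |z j - p x₀ j| ≤ (Fintype.card I : ℝ) / N) ∧
      (z i - (Fintype.card I : ℝ) / N) * (∑ j, g j z) ≤ g i z := by
    intro i
    by_cases hi : i ∈ S
    · obtain ⟨x, hx, rfl⟩ := mem_image.1 hi
      refine ⟨p x, hclose x hx x₀ hx₀, le_trans ?_ (hc x)⟩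
      apply mul_le_mul_of_nonneg_right _ (sum_nonneg fun j _ => hg0 j _)
      have : (0 : ℝ) ≤ (Fintype.card I : ℝ) / N := by positivity
      linarith
    · refine ⟨p x₀, hclose x₀ hx₀ x₀ hx₀, le_trans ?_ (hg0 _ _)⟩
      apply mul_nonpos_of_nonpos_of_nonneg _ (sum_nonneg fun j _ => hg0 j _)
      have h1 := hcoord x₀ hx₀ i
      rw [if_neg hi, zero_add] at h1
      have h1' : ((x₀.1 i : ℕ) : ℝ) ≤ Fintype.card I := by exact_mod_cast h1
      rw [sub_nonpos]
      simp only [p]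
      gcongr
  choose z hz1 hz2 using hz
  exact ⟨p x₀, hp x₀, z, fun i => ⟨hz1 i, hz2 i⟩⟩

open Filter Topology in
theorem simplex_kkm {I : Type*} [Fintype I] [DecidableEq I] [Nonempty I]
    (g : I → (I → ℝ) → ℝ) (hg0 : ∀ i t, 0 ≤ g i t) (hgc : ∀ i, Continuous (g i))
    (hcov : ∀ t ∈ stdSimplex ℝ I, ∃ i, 0 < t i ∧ g i t = 0) :
    ∃ t ∈ stdSimplex ℝ I, ∀ i, g i t = 0 := by
  choose x hx z hz using fun n : ℕ => approx g hg0 (n + 1) n.succ_pos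
  obtain ⟨t, ht, φ, hφ, hlim⟩ := (isCompact_stdSimplex ℝ I).tendsto_subseq hx
  have heps : Tendsto (fun n : ℕ => (Fintype.card I : ℝ) / ((φ n + 1 : ℕ) : ℝ)) atTop (𝓝 0) := by
    have h1 : Tendsto (fun n : ℕ => (Fintype.card I : ℝ) / ((n + 1 : ℕ) : ℝ)) atTop (𝓝 0) :=
      (tendsto_const_div_atTop_nhds_zero_nat (Fintype.card I : ℝ)).comp (tendsto_add_atTop_nat 1)
    exact h1.comp hφ.tendsto_atTop
  have hzlim : ∀ i, Tendsto (fun n => z (φ n) i) atTop (𝓝 t) := by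
    intro i
    rw [tendsto_pi_nhds]
    intro j
    have h1 : Tendsto (fun n => z (φ n) i j - x (φ n) j) atTop (𝓝 0) :=
      squeeze_zero_norm (fun n => (hz (φ n) i).1 j) heps
    have h2 : Tendsto (fun n => x (φ n) j) atTop (𝓝 (t j)) := (tendsto_pi_nhds.1 hlim) j
    simpa using h1.add h2
  have hkey : ∀ i, t i * ∑ j, g j t ≤ g i t := by
    intro i
    have hr : Tendsto (fun n => g i (z (φ n) i)) atTop (𝓝 (g i t)) :=
      ((hgc i).tendsto t).comp (hzlim i)
    have hs : Tendsto (fun n => ∑ j, g j (z (φ n) i)) atTop (𝓝 (∑ j, g j t)) :=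
      tendsto_finsetSum _ fun j _ => ((hgc j).tendsto t).comp (hzlim i)
    have hl := (((tendsto_pi_nhds.1 (hzlim i)) i).sub heps).mul hs
    rw [sub_zero] at hl
    exact le_of_tendsto_of_tendsto' hl hr fun n => (hz (φ n) i).2
  have heq : ∀ i, t i * ∑ j, g j t = g i t := by
    have h1 : ∑ i, t i * ∑ j, g j t = ∑ i, g i t := by rw [← sum_mul, ht.2, one_mul]
    exact fun i => (sum_eq_sum_iff_of_le fun i _ => hkey i).1 h1 i (mem_univ i)
  obtain ⟨i, hi, hgi⟩ := hcov t ht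
  have hD : ∑ j, g j t = 0 := by
    have := heq i
    rw [hgi] at this
    exact (mul_eq_zero.1 this).resolve_left hi.ne'
  exact ⟨t, ht, fun i => by rw [← heq i, hD, mul_zero]⟩

end KKMAux


/-- **Knaster–Kuratowski–Mazurkiewicz lemma.**
Let `S = conv(v₀, …, v_d) ⊂ ℝ^d` be a `d`-simplex (the `v i` affinely independent)
and `C₀, …, C_d` closed subsets of `S` such that every face
`conv(v_{i₁}, …, v_{iₙ})` (for a nonempty index set `I = {i₁, …, iₙ}`) is covered by
`C_{i₁} ∪ ⋯ ∪ C_{iₙ}`.  Then `⋂ i, C i` is nonempty. -/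
theorem kkm_lemma (d : ℕ) (v : Fin (d + 1) → EuclideanSpace ℝ (Fin d))
    (hv : AffineIndependent ℝ v)
    (C : Fin (d + 1) → Set (EuclideanSpace ℝ (Fin d)))
    (hC_closed : ∀ i, IsClosed (C i))
    (hC_sub : ∀ i, C i ⊆ convexHull ℝ (Set.range v))
    (hcover : ∀ I : Finset (Fin (d + 1)), I.Nonempty →
      convexHull ℝ (v '' (I : Set (Fin (d + 1)))) ⊆ ⋃ i ∈ I, C i) :
    (⋂ i, C i).Nonempty := by
  classical
  have hvC : ∀ i, v i ∈ C i := by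
    intro i
    have := hcover {i} (Finset.singleton_nonempty i)
    simpa using this
  obtain ⟨t, ht, h⟩ := KKMAux.simplex_kkm
    (fun i t => Metric.infDist (∑ j, t j • v j) (C i))
    (fun i t => Metric.infDist_nonneg)
    (fun i => (Metric.continuous_infDist_pt (C i)).comp (by fun_prop))
    (by
      intro t ht
      let J : Finset (Fin (d + 1)) := Finset.univ.filter (fun i => 0 < t i)
      have hsupp : ∀ i, i ∉ J → t i = 0 := by
        intro i hi
        simp only [J, Finset.mem_filter, Finset.mem_univ, true_and, not_lt] at hi
        exact le_antisymm hi (ht.1 i)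
      have hsum : ∑ i ∈ J, t i = 1 := by
        rw [← ht.2]
        exact Finset.sum_subset (Finset.subset_univ _) fun i _ hi => hsupp i hi
      have hJ : J.Nonempty := by
        rw [Finset.nonempty_iff_ne_empty]
        rintro hJ
        rw [hJ] at hsum
        simp at hsum
      have hmem : ∑ j, t j • v j ∈ convexHull ℝ (v '' (J : Set (Fin (d + 1)))) := by
        have : ∑ j, t j • v j = ∑ j ∈ J, t j • v j := by
          symm
          exact Finset.sum_subset (Finset.subset_univ _) fun i _ hi => by rw [hsupp i hi, zero_smul]
        rw [this]
        exact (convex_convexHull ℝ _).sum_mem (fun i _ => ht.1 i) hsum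
          fun i hi => subset_convexHull ℝ _ ⟨i, hi, rfl⟩
      have := hcover J hJ hmem
      simp only [Set.mem_iUnion] at this
      obtain ⟨i, hi, hCi⟩ := this
      exact ⟨i, (Finset.mem_filter.1 hi).2, Metric.infDist_zero_of_mem hCi⟩)
  refine ⟨∑ j, t j • v j, Set.mem_iInter.2 fun i => ?_⟩
  exact ((hC_closed i).mem_iff_infDist_zero ⟨_, hvC i⟩).2 (h i)
end

section
/- Let S = conv(v₀, …, v_d) ⊂ ℝ^d be a d-simplex spanned by affinely independent points v₀, …, v_d, and let F : S → S be a continuous mapping of S into itself. Then there exists a point x ∈ S with F(x) = x. -/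
/-- Scarf dominance. -/
def ScarfDom {X I : Type*} (R : I → X → ℕ) (ρ : Finset X) : Prop :=
  ∀ y, ∃ i, ∀ x ∈ ρ, R i y ≤ R i x

theorem scarf_door {X I : Type*} [Fintype X] [DecidableEq X] [Fintype I] [DecidableEq I]
    (R : I → X → ℕ) (hR : ∀ i, Function.Injective (R i)) (δ : Finset X) (hne : δ.Nonempty)
    (hcard : δ.card + 1 = Fintype.card I) (hD : ScarfDom R δ)
    (hM : ∀ a, ∃ y, ∀ k, k ≠ a → ∃ z ∈ δ, R k z < R k y) :
    ∃ u w, u ≠ w ∧ ∀ x, (x ∉ δ ∧ ScarfDom R (insert x δ)) ↔ (x = u ∨ x = w) := by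
  have h1 : ∀ i, ∃ z ∈ δ, ∀ x ∈ δ, R i z ≤ R i x := fun i => Finset.exists_min_image δ (R i) hne
  choose m hmδ hm using h1
  have surj : ∀ x ∈ δ, ∃ i, m i = x := by
    intro x hx
    obtain ⟨i, hi⟩ := hD x
    exact ⟨i, hR i (le_antisymm (hm i x hx) (hi _ (hmδ i)))⟩
  have cover : ∀ a b, a ≠ b → ¬ (∀ z ∈ δ, ∃ k, k ≠ a ∧ k ≠ b ∧ m k = z) := by
    intro a b hab h
    have hsub : δ ⊆ ((Finset.univ.erase a).erase b).image m := by
      intro z hz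
      obtain ⟨k, h1, h2, h3⟩ := h z hz
      simp only [Finset.mem_image, Finset.mem_erase, Finset.mem_univ, and_true]
      exact ⟨k, ⟨h2, h1⟩, h3⟩
    have h2 := (Finset.card_le_card hsub).trans Finset.card_image_le
    rw [Finset.card_erase_of_mem (by simp [hab.symm]), Finset.card_erase_of_mem (by simp),
      Finset.card_univ] at h2
    have := hne.card_pos
    omega
  obtain ⟨i, -, j, -, hij, hmij⟩ := Finset.exists_ne_map_eq_of_card_lt_of_maps_to
    (s := (Finset.univ : Finset I)) (t := δ) (f := m) (by rw [Finset.card_univ]; omega)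
    (fun k _ => hmδ k)
  have hg : ∀ a, ∃ g, (∀ k, k ≠ a → R k (m k) < R k g) ∧
      ∀ y, (∀ k, k ≠ a → R k (m k) < R k y) → R a y ≤ R a g := by
    intro a
    obtain ⟨y, hy⟩ := hM a
    have hy' : ∀ k, k ≠ a → R k (m k) < R k y := by
      intro k hk
      obtain ⟨z, hz, h⟩ := hy k hk
      exact (hm k z hz).trans_lt h
    obtain ⟨g, hg, hg'⟩ := Finset.exists_max_image
      (Finset.univ.filter fun y => ∀ k, k ≠ a → R k (m k) < R k y) (R a) ⟨y, by simpa using hy'⟩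
    exact ⟨g, by simpa using hg, fun y hy => hg' y (by simpa using hy)⟩
  choose g hg1 hg2 using hg
  have back : ∀ a b, a ≠ b → m a = m b → g a ∉ δ ∧ ScarfDom R (insert (g a) δ) := by
    intro a b hab hmab
    constructor
    · intro hga
      obtain ⟨k, hk⟩ := surj _ hga
      by_cases hka : k = a
      · have := hg1 a b hab.symm
        rw [← hmab, ← hk, hka] at this
        exact lt_irrefl _ this
      · have := hg1 a k hka
        rw [hk] at this
        exact lt_irrefl _ this
    · intro y
      by_cases hy : ∀ k, k ≠ a → R k (m k) < R k y
      · refine ⟨a, fun x hx => ?_⟩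
        rcases Finset.mem_insert.1 hx with rfl | hx
        · exact hg2 a y hy
        · obtain ⟨k, hk⟩ := hD y
          by_cases hka : k = a
          · subst hka; exact hk x ‹x ∈ δ›
          · exact absurd (hy k hka) (not_lt.2 (hk _ (hmδ k)))
      · push Not at hy
        obtain ⟨k, hka, hk⟩ := hy
        refine ⟨k, fun x hx => ?_⟩
        rcases Finset.mem_insert.1 hx with rfl | hx
        · exact hk.trans (hg1 a k hka).le
        · exact hk.trans (hm k x hx)
  refine ⟨g i, g j, ?_, fun x => ⟨?_, ?_⟩⟩
  · intro h
    obtain ⟨k, hk⟩ := hD (g i)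
    have hk := hk _ (hmδ k)
    by_cases hki : k = i
    · have := hg1 j k (hki ▸ hij)
      rw [← h] at this
      omega
    · have := hg1 i k hki
      omega
  · rintro ⟨hx, hxD⟩
    obtain ⟨a, ha⟩ := hxD x
    have key : ∀ z ∈ δ, ∃ k, k ≠ a ∧ m k = z ∧ R k z ≤ R k x := by
      intro z hz
      obtain ⟨k, hk⟩ := hxD z
      refine ⟨k, ?_, ?_, hk x (by simp)⟩
      · rintro rfl
        have := hR k (le_antisymm (hk x (by simp)) (ha z (by simp [hz])))
        exact hx (this ▸ hz)
      · exact hR k (le_antisymm (hm k z hz) (hk _ (by simp [hmδ])))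
    have haij : a = i ∨ a = j := by
      by_contra hcon
      push Not at hcon
      refine cover a i hcon.1 fun z hz => ?_
      obtain ⟨k, h1, h2, -⟩ := key z hz
      by_cases hki : k = i
      · exact ⟨j, hcon.2.symm, hij.symm, by rw [← hmij, ← hki, h2]⟩
      · exact ⟨k, h1, hki, h2⟩
    have hxM : ∀ k, k ≠ a → R k (m k) < R k x := by
      intro k hka
      by_contra hlt
      push Not at hlt
      refine cover a k hka.symm fun z hz => ?_
      obtain ⟨l, h1, h2, h3⟩ := key z hz
      refine ⟨l, h1, ?_, h2⟩
      rintro rfl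
      rw [h2] at hlt
      exact hx (hR l (le_antisymm hlt h3) ▸ hz)
    have hxg : x = g a := by
      refine hR a (le_antisymm (hg2 a x hxM) ?_)
      obtain ⟨k, hk⟩ := hxD (g a)
      by_cases hka : k = a
      · subst hka; exact hk x (by simp)
      · exact absurd (hg1 a k hka) (not_lt.2 (hk _ (by simp [hmδ])))
    rcases haij with rfl | rfl
    · exact Or.inl hxg
    · exact Or.inr hxg
  · rintro (rfl | rfl)
    · exact back i j hij hmij
    · exact back j i hij.symm hmij.symm

/-- Parity argument. -/
theorem scarf_parity {X I : Type*} [Fintype X] [DecidableEq X] [Fintype I] [DecidableEq I]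
    (R : I → X → ℕ) (c : X → I) (i0 : I) (δ0 : Finset X)
    (h0c : δ0.card + 1 = Fintype.card I) (h0 : δ0.image c = Finset.univ.erase i0)
    (h0u : ∃ u, ∀ x, (x ∉ δ0 ∧ ScarfDom R (insert x δ0)) ↔ x = u)
    (hd : ∀ δ : Finset X, δ ≠ δ0 → δ.card + 1 = Fintype.card I →
      δ.image c = Finset.univ.erase i0 → ScarfDom R δ →
      ∃ u w, u ≠ w ∧ ∀ x, (x ∉ δ ∧ ScarfDom R (insert x δ)) ↔ (x = u ∨ x = w)) :
    ∃ ρ : Finset X, ScarfDom R ρ ∧ ρ.image c = Finset.univ := by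
  classical
  by_contra hcon
  push Not at hcon
  let P : Finset (Finset X × X) := Finset.univ.filter fun p =>
    p.2 ∉ p.1 ∧ p.1.card + 1 = Fintype.card I ∧ p.1.image c = Finset.univ.erase i0 ∧
      ScarfDom R (insert p.2 p.1)
  have hP : ∀ δ x, (δ, x) ∈ P ↔ (x ∉ δ ∧ δ.card + 1 = Fintype.card I ∧
      δ.image c = Finset.univ.erase i0 ∧ ScarfDom R (insert x δ)) := by
    intro δ x; simp [P]
  have e1 : P.card = ∑ ρ : Finset X, (P.filter fun p => insert p.2 p.1 = ρ).card :=
    Finset.card_eq_sum_card_fiberwise (fun _ _ => by simp)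
  have e2 : P.card = ∑ δ : Finset X, (P.filter fun p => p.1 = δ).card :=
    Finset.card_eq_sum_card_fiberwise (fun _ _ => by simp)
  have hev : Even P.card := by
    rw [e1]
    refine Finset.even_sum _ fun ρ _ => ?_
    rcases (P.filter fun p => insert p.2 p.1 = ρ).eq_empty_or_nonempty with h | ⟨⟨δ, x⟩, h⟩
    · rw [h]; simp
    · rw [Finset.mem_filter, hP] at h
      obtain ⟨⟨hx, hc, him, hD⟩, hρ⟩ := h
      simp only at hρ
      have hinj : Set.InjOn c δ := by
        rw [← Finset.card_image_iff, him, Finset.card_erase_of_mem (by simp), Finset.card_univ]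
        omega
      have hcx : c x ≠ i0 := by
        intro hcx
        apply hcon _ hD
        rw [Finset.image_insert, him, hcx, Finset.insert_erase (by simp)]
      have : c x ∈ δ.image c := by rw [him]; simp [hcx]
      obtain ⟨z, hz, hzx⟩ := Finset.mem_image.1 this
      have hzne : z ≠ x := fun h => hx (h ▸ hz)
      suffices hs : (P.filter fun p => insert p.2 p.1 = ρ) = {(δ, x), (ρ.erase z, z)} by
        rw [hs, Finset.card_pair]
        · exact even_two
        · intro h; exact hzne (Prod.ext_iff.1 h).2.symm
      have hzρ : z ∈ ρ := by rw [← hρ]; simp [hz]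
      ext ⟨ε, y⟩
      rw [Finset.mem_filter, hP]
      simp only [Finset.mem_insert, Finset.mem_singleton, Prod.mk.injEq]
      constructor
      · rintro ⟨⟨hy, hc', him', hD'⟩, hρ'⟩
        have hε : ε = ρ.erase y := by rw [← hρ', Finset.erase_insert hy]
        by_cases hyx : y = x
        · left
          subst hyx
          exact ⟨by rw [hε, ← hρ, Finset.erase_insert hx], rfl⟩
        · right
          have hinj' : Set.InjOn c ε := by
            rw [← Finset.card_image_iff, him', Finset.card_erase_of_mem (by simp),
              Finset.card_univ]
            omega
          have hyz : y = z := by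
            by_contra hyz
            have hxe : x ∈ ε := by rw [hε, ← hρ]; simp [Ne.symm hyx]
            have hze : z ∈ ε := by rw [hε]; simp [Ne.symm hyz, hzρ]
            exact hzne (hinj' hze hxe hzx)
          subst hyz
          exact ⟨hε, rfl⟩
      · rintro (⟨rfl, rfl⟩ | ⟨rfl, rfl⟩)
        · exact ⟨⟨hx, hc, him, hD⟩, hρ⟩
        · refine ⟨⟨by simp, ?_, ?_, ?_⟩, Finset.insert_erase hzρ⟩
          · rw [Finset.card_erase_of_mem hzρ, ← hρ, Finset.card_insert_of_notMem hx]
            omega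
          · rw [← him, ← hρ]
            ext k
            simp only [Finset.mem_image, Finset.mem_erase, Finset.mem_insert]
            constructor
            · rintro ⟨a, ⟨h1, rfl | h2⟩, rfl⟩
              · exact ⟨y, hz, hzx⟩
              · exact ⟨a, h2, rfl⟩
            · rintro ⟨a, h, rfl⟩
              by_cases hay : a = y
              · exact ⟨x, ⟨hzne.symm, Or.inl rfl⟩, by rw [hay, hzx]⟩
              · exact ⟨a, ⟨hay, Or.inr h⟩, rfl⟩
          · rw [Finset.insert_erase hzρ, ← hρ]; exact hD
  have hodd : ¬ Even P.card := by
    rw [e2, ← Finset.add_sum_erase _ _ (Finset.mem_univ δ0)]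
    have hc0 : (P.filter fun p => p.1 = δ0).card = 1 := by
      obtain ⟨u, hu⟩ := h0u
      rw [Finset.card_eq_one]
      refine ⟨(δ0, u), ?_⟩
      ext ⟨ε, y⟩
      rw [Finset.mem_filter, hP]
      simp only [Finset.mem_singleton, Prod.mk.injEq]
      constructor
      · rintro ⟨⟨h1, -, -, h2⟩, rfl⟩
        exact ⟨rfl, (hu y).1 ⟨h1, h2⟩⟩
      · rintro ⟨rfl, rfl⟩
        have := (hu y).2 rfl
        exact ⟨⟨this.1, h0c, h0, this.2⟩, rfl⟩
    have hce : Even (∑ δ ∈ Finset.univ.erase δ0, (P.filter fun p => p.1 = δ).card) := by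
      refine Finset.even_sum _ fun δ hδ => ?_
      rcases (P.filter fun p => p.1 = δ).eq_empty_or_nonempty with h | ⟨⟨δ', x⟩, h⟩
      · rw [h]; simp
      · rw [Finset.mem_filter, hP] at h
        obtain ⟨⟨hx, hc, him, hD⟩, hρ⟩ := h
        simp only at hρ
        subst hρ
        obtain ⟨u, w, huw, hiff⟩ := hd δ' (Finset.ne_of_mem_erase hδ) hc him (fun y => by
          obtain ⟨i, hi⟩ := hD y
          exact ⟨i, fun x hx => hi x (by simp [hx])⟩)
        suffices hs : (P.filter fun p => p.1 = δ') = {(δ', u), (δ', w)} by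
          rw [hs, Finset.card_pair]
          · exact even_two
          · intro h; exact huw (Prod.ext_iff.1 h).2
        ext ⟨ε, y⟩
        rw [Finset.mem_filter, hP]
        simp only [Finset.mem_insert, Finset.mem_singleton, Prod.mk.injEq, ← and_or_left]
        constructor
        · rintro ⟨⟨h1, -, -, h2⟩, rfl⟩
          exact ⟨rfl, (hiff y).1 ⟨h1, h2⟩⟩
        · rintro ⟨rfl, h⟩
          have := (hiff y).2 h
          exact ⟨⟨this.1, hc, him, this.2⟩, rfl⟩
    rw [hc0, Nat.even_add]
    simp [hce]
  exact hodd hev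

theorem scarf_lemma {T : Type*} [Fintype T] [DecidableEq T] [Nonempty T] {d : ℕ}
    (r : Fin (d + 1) → T → ℕ) (hr : ∀ i, Function.Injective (r i)) (c : T → Fin (d + 1)) :
    ∃ (σ : Finset T) (C : Finset (Fin (d + 1))),
      (∀ i ∈ C, ∃ t ∈ σ, c t = i) ∧ ∀ y, ∃ i ∈ C, ∀ t ∈ σ, r i y ≤ r i t := by
  classical
  obtain ⟨B, hB⟩ : ∃ B, ∀ i t, r i t < B := by
    refine ⟨(∑ i, ∑ t, r i t) + 1, fun i t => Nat.lt_succ_of_le ?_⟩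
    exact (Finset.single_le_sum (f := r i) (fun _ _ => Nat.zero_le _) (Finset.mem_univ t)).trans
      (Finset.single_le_sum (f := fun i => ∑ t, r i t) (fun _ _ => Nat.zero_le _)
        (Finset.mem_univ i))
  let R : Fin (d + 1) → T ⊕ Fin (d + 1) → ℕ := fun i =>
    Sum.elim (fun t => r i t + 1) (fun j => if j = i then 0 else B + 1 + j)
  have Rl : ∀ i t, R i (Sum.inl t) = r i t + 1 := fun _ _ => rfl
  have Rs : ∀ i, R i (Sum.inr i) = 0 := fun i => by simp [R]
  have Rr : ∀ i j, j ≠ i → R i (Sum.inr j) = B + 1 + j := fun i j h => by simp [R, h]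
  have hR : ∀ i, Function.Injective (R i) := by
    rintro i (a | a) (b | b) h
    · rw [Rl, Rl] at h
      rw [hr i (Nat.succ_injective h)]
    · have := hB i a
      by_cases hb : b = i
      · rw [hb, Rl, Rs] at h; omega
      · rw [Rl, Rr _ _ hb] at h; omega
    · have := hB i b
      by_cases hb : a = i
      · rw [hb, Rl, Rs] at h; omega
      · rw [Rl, Rr _ _ hb] at h; omega
    · by_cases ha : a = i <;> by_cases hb : b = i
      · rw [ha, hb]
      · rw [ha, Rs, Rr _ _ hb] at h; omega
      · rw [hb, Rs, Rr _ _ ha] at h; omega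
      · rw [Rr _ _ hb, Rr _ _ ha] at h
        congr 1
        exact Fin.ext (by omega)
  let c' : T ⊕ Fin (d + 1) → Fin (d + 1) := Sum.elim c id
  let δ0 : Finset (T ⊕ Fin (d + 1)) := (Finset.univ.erase 0).image Sum.inr
  have hδ0 : ∀ x, x ∈ δ0 ↔ ∃ j, j ≠ 0 ∧ Sum.inr j = x := by intro x; simp [δ0]
  have hδ0c : δ0.card + 1 = Fintype.card (Fin (d + 1)) := by
    rw [Finset.card_image_of_injective _ Sum.inr_injective, Finset.card_erase_of_mem (by simp)]
    simp
  obtain ⟨ρ, hρD, hρ⟩ := scarf_parity R c' 0 δ0 hδ0c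
    (by ext k; simp [δ0, c', Finset.mem_image])
    (by
      obtain ⟨u, -, hu⟩ := Finset.exists_max_image (Finset.univ : Finset T) (r 0)
        Finset.univ_nonempty
      have hu : ∀ t, r 0 t ≤ r 0 u := fun t => hu t (Finset.mem_univ t)
      refine ⟨Sum.inl u, fun x => ⟨?_, ?_⟩⟩
      · rintro ⟨hx, hD⟩
        obtain ⟨i, hi⟩ := hD (Sum.inl u)
        have hi0 : i = 0 := by
          by_contra hi0
          have := hi (Sum.inr i) (by simp [hδ0, hi0])
          rw [Rl, Rs] at this; omega
        subst hi0
        have := hi x (by simp)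
        rcases x with t | j
        · rw [Rl, Rl] at this
          have h2 := hu t
          rw [hr 0 (show r 0 t = r 0 u by omega)]
        · by_cases hj : j = 0
          · rw [hj, Rl, Rs] at this; omega
          · exact absurd ((hδ0 _).2 ⟨j, hj, rfl⟩) hx
      · rintro rfl
        refine ⟨by simp [hδ0], ?_⟩
        rintro (t | j)
        · refine ⟨0, fun x hx => ?_⟩
          rcases Finset.mem_insert.1 hx with rfl | hx
          · rw [Rl, Rl]; have := hu t; omega
          · obtain ⟨j, hj, rfl⟩ := (hδ0 _).1 hx
            rw [Rl, Rr _ _ hj]; have := hB 0 t; omega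
        · exact ⟨j, fun x _ => by rw [Rs]; omega⟩)
    (by
      intro δ hne hc him hD
      have ht : ∃ t, Sum.inl t ∈ δ := by
        by_contra hcon
        push Not at hcon
        apply hne
        apply Finset.eq_of_subset_of_card_le
        · rintro (t | j) hx
          · exact absurd hx (hcon t)
          · refine (hδ0 _).2 ⟨j, ?_, rfl⟩
            have : c' (Sum.inr j) ∈ δ.image c' := Finset.mem_image_of_mem _ hx
            rw [him] at this
            simpa [c'] using this
        · omega
      obtain ⟨t, ht⟩ := ht
      refine scarf_door R hR δ ⟨_, ht⟩ hc hD fun a => ⟨Sum.inr a, fun k hk => ⟨_, ht, ?_⟩⟩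
      rw [Rl, Rr _ _ hk.symm]; have := hB k t; omega)
  refine ⟨Finset.univ.filter fun t => Sum.inl t ∈ ρ, Finset.univ.filter fun i => Sum.inr i ∉ ρ,
    ?_, ?_⟩
  · intro i hi
    have hi : Sum.inr i ∉ ρ := by simpa using hi
    have : i ∈ ρ.image c' := by rw [hρ]; simp
    obtain ⟨x, hx, hxi⟩ := Finset.mem_image.1 this
    rcases x with t | j
    · exact ⟨t, by simpa using hx, hxi⟩
    · have : j = i := hxi
      exact absurd (this ▸ hx) hi
  · intro y
    obtain ⟨i, hi⟩ := hρD (Sum.inl y)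
    refine ⟨i, ?_, fun t ht => ?_⟩
    · simp only [Finset.mem_filter, Finset.mem_univ, true_and]
      intro h
      have := hi _ h
      rw [Rl, Rs] at this; omega
    · have := hi (Sum.inl t) (by simpa using ht)
      rw [Rl, Rl] at this; omega

theorem grid_step {d : ℕ} (N : ℕ) (c : (Fin (d + 1) → ℕ) → Fin (d + 1)) :
    ∃ p : Fin (d + 1) → ℕ, ∑ i, p i = N ∧ ∀ i, ∃ q : Fin (d + 1) → ℕ, ∑ i, q i = N ∧
      (∀ j, q j ≤ p j + (d + 1) ∧ p j ≤ q j + (d + 1)) ∧ (c q = i ∨ q i ≤ d + 1) := by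
  classical
  let T := {x : Fin (d + 1) → Fin (N + 1) // ∑ i, (x i : ℕ) = N}
  have mk : ∀ (f : Fin (d + 1) → ℕ), ∑ i, f i ≤ N → ∃ y : T, ∀ i, f i ≤ (y.1 i : ℕ) := by
    intro f hf
    let g : Fin (d + 1) → ℕ := f + Pi.single 0 (N - ∑ i, f i)
    have hg : ∑ i, g i = N := by
      simp only [g, Pi.add_apply, Finset.sum_add_distrib]
      rw [Finset.sum_pi_single']
      simp; omega
    have hgl : ∀ i, g i ≤ N := fun i => by
      rw [← hg]
      exact Finset.single_le_sum (f := g) (fun _ _ => Nat.zero_le _) (Finset.mem_univ i)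
    exact ⟨⟨fun i => ⟨g i, Nat.lt_succ_of_le (hgl i)⟩, hg⟩, fun i => by simp [g]⟩
  have : Nonempty T := ⟨(mk 0 (by simp)).choose⟩
  let e := Fintype.equivFin T
  let K := Fintype.card T
  let r : Fin (d + 1) → T → ℕ := fun i x => (x.1 i : ℕ) * K + e x
  have hrle : ∀ i x y, r i x ≤ r i y → (x.1 i : ℕ) ≤ y.1 i := by
    intro i x y h
    by_contra hlt
    push Not at hlt
    have h1 : ((y.1 i : ℕ) + 1) * K ≤ (x.1 i : ℕ) * K := Nat.mul_le_mul_right _ hlt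
    have h2 : (e y : ℕ) < K := (e y).2
    simp only [r] at h
    rw [add_mul] at h1
    omega
  have hr : ∀ i, Function.Injective (r i) := by
    intro i x y h
    have h3 := le_antisymm (hrle i x y h.le) (hrle i y x h.ge)
    simp only [r] at h
    rw [h3] at h
    exact e.injective (Fin.ext (by omega))
  obtain ⟨σ, C, hC, hdom⟩ := scarf_lemma r hr (fun x => c (fun i => (x.1 i : ℕ)))
  obtain ⟨t0, ht0⟩ : σ.Nonempty := by
    obtain ⟨i, hi, -⟩ := hdom (Classical.arbitrary T)
    obtain ⟨t, ht, -⟩ := hC i hi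
    exact ⟨t, ht⟩
  have hm : ∀ i, ∃ z ∈ σ, ∀ x ∈ σ, (z.1 i : ℕ) ≤ x.1 i :=
    fun i => Finset.exists_min_image σ (fun x => (x.1 i : ℕ)) ⟨t0, ht0⟩
  choose m hmσ hm using hm
  let M : Fin (d + 1) → ℕ := fun j => if j ∈ C then ((m j).1 j : ℕ) else 0
  have hM : ∀ t ∈ σ, ∀ j, M j ≤ (t.1 j : ℕ) := by
    intro t ht j
    by_cases hj : j ∈ C
    · simpa [M, hj] using hm j t ht
    · simp [M, hj]
  have hsum : N < ∑ j, M j + (d + 1) := by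
    by_contra hle
    push Not at hle
    obtain ⟨y, hy⟩ := mk (fun j => M j + 1) (by rw [Finset.sum_add_distrib]; simpa using hle)
    obtain ⟨i, hi, h⟩ := hdom y
    have h1 := hrle _ _ _ (h _ (hmσ i))
    have h2 := hy i
    simp only [M, hi, if_true] at h2
    omega
  have hup : ∀ t ∈ σ, ∀ j, (t.1 j : ℕ) ≤ M j + (d + 1) := by
    intro t ht j
    have h1 := t.2
    rw [← Finset.add_sum_erase _ _ (Finset.mem_univ j)] at h1 hsum
    have h2 : ∑ j ∈ Finset.univ.erase j, M j ≤ ∑ j ∈ Finset.univ.erase j, (t.1 j : ℕ) :=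
      Finset.sum_le_sum fun k _ => hM t ht k
    omega
  refine ⟨fun i => t0.1 i, t0.2, fun i => ?_⟩
  by_cases hi : i ∈ C
  · obtain ⟨t, ht, htc⟩ := hC i hi
    refine ⟨fun i => t.1 i, t.2, fun j => ?_, Or.inl htc⟩
    have := hup t ht j
    have := hup t0 ht0 j
    have := hM t ht j
    have := hM t0 ht0 j
    constructor <;> (beta_reduce; omega)
  · refine ⟨fun i => t0.1 i, t0.2, fun j => ⟨by omega, by omega⟩, Or.inr ?_⟩
    simpa [M, hi] using hup t0 ht0 i

theorem brouwer_std {d : ℕ} (F : (Fin (d + 1) → ℝ) → (Fin (d + 1) → ℝ))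
    (hF : Set.MapsTo F (stdSimplex ℝ (Fin (d + 1))) (stdSimplex ℝ (Fin (d + 1))))
    (hFc : ContinuousOn F (stdSimplex ℝ (Fin (d + 1)))) :
    ∃ x ∈ stdSimplex ℝ (Fin (d + 1)), F x = x := by
  classical
  have step : ∀ n : ℕ, ∃ p ∈ stdSimplex ℝ (Fin (d + 1)), ∀ i, ∃ q ∈ stdSimplex ℝ (Fin (d + 1)),
      (∀ j, |q j - p j| ≤ (d + 1) * (1 / ((n : ℝ) + 1))) ∧
      q i ≤ F q i + (d + 1) * (1 / ((n : ℝ) + 1)) := by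
    intro n
    have hn : (0 : ℝ) < n + 1 := by positivity
    let s : (Fin (d + 1) → ℕ) → (Fin (d + 1) → ℝ) := fun q i => (q i : ℝ) / (n + 1)
    have hs : ∀ q, ∑ i, q i = n + 1 → s q ∈ stdSimplex ℝ (Fin (d + 1)) := by
      intro q hq
      refine ⟨fun i => by simp only [s]; positivity, ?_⟩
      simp only [s]
      rw [← Finset.sum_div, ← Nat.cast_sum, hq]
      push_cast
      exact div_self hn.ne'
    have hc : ∀ q, ∃ i, ∑ i, q i = n + 1 → s q i ≤ F (s q) i := by
      intro q
      by_cases hq : ∑ i, q i = n + 1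
      · have h1 := hs q hq
        have h2 := hF h1
        obtain ⟨i, -, hi⟩ := Finset.exists_le_of_sum_le (s := Finset.univ) (f := s q)
          (g := F (s q)) Finset.univ_nonempty (by rw [h1.2, h2.2])
        exact ⟨i, fun _ => hi⟩
      · exact ⟨0, fun h => absurd h hq⟩
    choose c hc using hc
    obtain ⟨p, hp, hpq⟩ := grid_step (n + 1) c
    refine ⟨s p, hs p hp, fun i => ?_⟩
    obtain ⟨q, hq, hqp, hqi⟩ := hpq i
    refine ⟨s q, hs q hq, fun j => ?_, ?_⟩
    · obtain ⟨h1, h2⟩ := hqp j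
      have h1' : (q j : ℝ) ≤ p j + (d + 1) := by exact_mod_cast h1
      have h2' : (p j : ℝ) ≤ q j + (d + 1) := by exact_mod_cast h2
      simp only [s]
      rw [← sub_div, abs_div, abs_of_pos hn, mul_one_div]
      gcongr
      rw [abs_le]; constructor <;> linarith
    · rcases hqi with h | h
      · have := hc q hq
        rw [h] at this
        have : 0 ≤ ((d : ℝ) + 1) * (1 / ((n : ℝ) + 1)) := by positivity
        linarith
      · have h' : (q i : ℝ) ≤ d + 1 := by exact_mod_cast h
        have h0 := (hF (hs q hq)).1 i
        have : s q i ≤ (d + 1) * (1 / ((n : ℝ) + 1)) := by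
          simp only [s]; rw [mul_one_div]; gcongr
        linarith
  choose p hp q hq hqp hqF using step
  obtain ⟨a, ha, φ, hφ, hlim⟩ := (isCompact_stdSimplex ℝ (Fin (d + 1))).tendsto_subseq hp
  have hz : Filter.Tendsto (fun n => ((d : ℝ) + 1) * (1 / ((φ n : ℝ) + 1))) Filter.atTop
      (nhds 0) := by
    have := (tendsto_one_div_add_atTop_nhds_zero_nat (𝕜 := ℝ)).comp hφ.tendsto_atTop
    simpa [Function.comp_def] using this.const_mul ((d : ℝ) + 1)
  have hle : ∀ i, a i ≤ F a i := by
    intro i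
    have hqa : Filter.Tendsto (fun n => q (φ n) i) Filter.atTop (nhds a) := by
      rw [tendsto_pi_nhds] at hlim ⊢
      intro j
      have h1 : Filter.Tendsto (fun n => q (φ n) i j - p (φ n) j) Filter.atTop (nhds 0) :=
        squeeze_zero_norm (fun n => hqp (φ n) i j) hz
      simpa using h1.add (hlim j)
    have hFa : Filter.Tendsto (fun n => F (q (φ n) i)) Filter.atTop (nhds (F a)) :=
      (hFc a ha).tendsto.comp (tendsto_nhdsWithin_iff.2
        ⟨hqa, Filter.Eventually.of_forall fun n => hq _ _⟩)
    have h1 := (tendsto_pi_nhds.1 hqa) i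
    have h2 := ((tendsto_pi_nhds.1 hFa) i).add hz
    rw [add_zero] at h2
    exact le_of_tendsto_of_tendsto' h1 h2 fun n => hqF _ _
  refine ⟨a, ha, ?_⟩
  have := (Finset.sum_eq_sum_iff_of_le (s := Finset.univ) (f := a) (g := F a)
    (fun i _ => hle i)).1 (by rw [ha.2, (hF ha).2])
  funext i
  exact (this i (Finset.mem_univ i)).symm

/-- **Brouwer's fixed point theorem for simplices.**
Let `S = conv(v₀, …, v_d) ⊂ ℝ^d` be a `d`-simplex spanned by affinely independent
points `v₀, …, v_d`, and let `F : S → S` be a continuous mapping of `S` into itself.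
Then there is a point `x ∈ S` with `F x = x`. -/
theorem brouwer_fixed_point_simplex (d : ℕ)
    (v : Fin (d + 1) → EuclideanSpace ℝ (Fin d))
    (hv : AffineIndependent ℝ v)
    (F : EuclideanSpace ℝ (Fin d) → EuclideanSpace ℝ (Fin d))
    (hF : Set.MapsTo F (convexHull ℝ (Set.range v)) (convexHull ℝ (Set.range v)))
    (hFc : ContinuousOn F (convexHull ℝ (Set.range v))) :
    ∃ x ∈ convexHull ℝ (Set.range v), F x = x := by
  have htop : affineSpan ℝ (Set.range v) = ⊤ := by
    rw [hv.affineSpan_eq_top_iff_card_eq_finrank_add_one]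
    simp
  let b : AffineBasis (Fin (d + 1)) ℝ (EuclideanSpace ℝ (Fin d)) := ⟨v, hv, htop⟩
  have hb : convexHull ℝ (Set.range v) = {x | ∀ i, 0 ≤ b.coord i x} :=
    b.convexHull_eq_nonneg_coord
  let φ : (Fin (d + 1) → ℝ) → EuclideanSpace ℝ (Fin d) := fun w => ∑ i, w i • v i
  have hφ : Continuous φ := by fun_prop
  have hφS : Set.MapsTo φ (stdSimplex ℝ (Fin (d + 1))) (convexHull ℝ (Set.range v)) := by
    intro w hw
    exact (convex_convexHull ℝ _).sum_mem (fun i _ => hw.1 i) hw.2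
      (fun i _ => subset_convexHull ℝ _ ⟨i, rfl⟩)
  let ψ : EuclideanSpace ℝ (Fin d) → (Fin (d + 1) → ℝ) := fun x i => b.coord i x
  have hψ : Continuous ψ := continuous_pi fun i => (b.coord i).continuous_of_finiteDimensional
  have hψS : Set.MapsTo ψ (convexHull ℝ (Set.range v)) (stdSimplex ℝ (Fin (d + 1))) := by
    intro x hx
    rw [hb] at hx
    exact ⟨hx, b.sum_coord_apply_eq_one x⟩
  have hφψ : ∀ x, φ (ψ x) = x := fun x => b.linear_combination_coord_eq_self x
  obtain ⟨w, hw, hfix⟩ := brouwer_std (fun w => ψ (F (φ w)))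
    (fun w hw => hψS (hF (hφS hw)))
    (hψ.comp_continuousOn (hFc.comp hφ.continuousOn hφS))
  refine ⟨φ w, hφS hw, ?_⟩
  conv_rhs => rw [← hfix]
  exact (hφψ _).symm
end
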